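/- arXiv:1908.10649 — 2 statements merged into one kernel-verified Lean document; each statement's English description precedes it below -/
import Mathlib

section
/- The finite derivative test D is an anonymous, reasonable and error-free cardinal comparison test. -/
open MeasureTheory Filter Set
open scoped ENNReal

/-- The space Ω^∞ of infinite binary sequences. -/
abbrev BinSeq : Type := ℕ → Bool

/-- The cylinder set `[ω^t]` of sequences agreeing with `ω` in the first `t` coordinates. -/
def cyl (ω : BinSeq) (t : ℕ) : Set BinSeq := {ω' | ∀ i < t, ω' i = ω i}

/-- A (candidate) cardinal comparison test: to each ordered pair of measures, each time `t`
and each realization `ω` it assigns a number. -/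
abbrev Test : Type := Measure BinSeq → Measure BinSeq → ℕ → BinSeq → ℝ

/-- The σ-algebra on `BinSeq` generated by the first `t` coordinates. -/
def coordAlg (t : ℕ) : MeasurableSpace BinSeq :=
  MeasurableSpace.comap (fun ω (i : Fin t) => ω (i : ℕ)) inferInstance

/-- A cardinal comparison test: values in `[0,1]`, and `T_t` is measurable with respect to the
σ-algebra generated by the first `t` coordinates, for every `t ≥ 1`. -/
def IsCCTest (T : Test) : Prop :=
  ∀ f g : Measure BinSeq, IsProbabilityMeasure f → IsProbabilityMeasure g →
    ∀ t : ℕ, 1 ≤ t →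
      (∀ ω, T f g t ω ∈ Set.Icc (0:ℝ) 1) ∧ @Measurable BinSeq ℝ (coordAlg t) _ (T f g t)

/-- `L_{T,ε}^{(f,g)}`: the set of `ω` where `lim_t T_t(ω,f,g)` exists and is `> ε`. -/
def LSet (T : Test) (f g : Measure BinSeq) (ε : ℝ) : Set BinSeq :=
  {ω | ∃ l : ℝ, Tendsto (fun t => T f g t ω) atTop (nhds l) ∧ ε < l}

/-- `R_{T,ε}^{(f,g)}`: the set of `ω` where `lim_t T_t(ω,f,g)` exists and is `< ε`. -/
def RSet (T : Test) (f g : Measure BinSeq) (ε : ℝ) : Set BinSeq :=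
  {ω | ∃ l : ℝ, Tendsto (fun t => T f g t ω) atTop (nhds l) ∧ l < ε}

/-- Anonymity: `T_t(ω,f,g) = 1 - T_t(ω,g,f)`. -/
def Anonymous (T : Test) : Prop :=
  ∀ f g : Measure BinSeq, IsProbabilityMeasure f → IsProbabilityMeasure g →
    ∀ t : ℕ, 1 ≤ t → ∀ ω, T f g t ω = 1 - T g f t ω

/-- Error-freeness. -/
def ErrorFree (T : Test) : Prop :=
  ∀ f g : Measure BinSeq, IsProbabilityMeasure f → IsProbabilityMeasure g →
    ∀ A : Set BinSeq, MeasurableSet A →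
      (∀ ε : ℝ, ε ∈ Set.Ioo 0 (1/2) →
        f (A ∩ RSet T f g ε) ≤ ENNReal.ofReal (ε / (1 - ε)) * g (A ∩ RSet T f g ε)) ∧
      (∀ ε : ℝ, ε ∈ Set.Ioo (1/2) 1 →
        g (A ∩ LSet T f g ε) ≤ ENNReal.ofReal ((1 - ε) / ε) * f (A ∩ LSet T f g ε))

/-- Reasonableness. -/
def Reasonable (T : Test) : Prop :=
  ∀ f g : Measure BinSeq, IsProbabilityMeasure f → IsProbabilityMeasure g →
    ∀ A : Set BinSeq, MeasurableSet A →
      (∀ ε : ℝ, ε ∈ Set.Ioo 0 (1/2) →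
        0 < g A → f A < ENNReal.ofReal (ε / (1 - ε)) * g A →
          0 < g (A ∩ RSet T f g ε)) ∧
      (∀ ε : ℝ, ε ∈ Set.Ioo (1/2) 1 →
        0 < f A → g A < ENNReal.ofReal ((1 - ε) / ε) * f A →
          0 < f (A ∩ LSet T f g ε))

/-- The finite derivative test `D`. -/
noncomputable def Dtest : Test := fun f g t ω =>
  match t with
  | 0 => 1/2
  | Nat.succ s =>
      if 0 < f (cyl ω s) + g (cyl ω s) then
        (f (cyl ω s)).toReal / ((f (cyl ω s)).toReal + (g (cyl ω s)).toReal)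
      else 1/2

/-- Restriction of a binary sequence to its first `t` coordinates. -/
def prefixMap (t : ℕ) (ω : BinSeq) (i : Fin t) : Bool := ω i

lemma measurable_prefixMap (t : ℕ) : Measurable (prefixMap t) :=
  measurable_pi_lambda _ fun i => measurable_pi_apply (i : ℕ)

lemma cyl_eq_preimage_prefixMap (ω : BinSeq) (t : ℕ) :
    cyl ω t = prefixMap t ⁻¹' {prefixMap t ω} := by
  ext ω'
  simp only [cyl, Set.mem_ofPred_eq, Set.mem_preimage, Set.mem_singleton_iff, funext_iff, prefixMap]
  exact ⟨fun h i => h i i.2, fun h i hi => h ⟨i, hi⟩⟩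

/-- The finite derivative test at time `t + 1`, as a function of the first `t` coordinates. -/
noncomputable def prefixRatio (f g : Measure BinSeq) (t : ℕ) (x : Fin t → Bool) : ℝ :=
  if 0 < f (prefixMap t ⁻¹' {x}) + g (prefixMap t ⁻¹' {x}) then
    f.real (prefixMap t ⁻¹' {x}) / (f.real (prefixMap t ⁻¹' {x}) + g.real (prefixMap t ⁻¹' {x}))
  else 1 / 2

lemma Dtest_succ (f g : Measure BinSeq) (t : ℕ) :
    Dtest f g (t + 1) = prefixRatio f g t ∘ prefixMap t := by
  ext ω
  simp only [Dtest, prefixRatio, Function.comp, cyl_eq_preimage_prefixMap]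
  rfl

lemma prefixRatio_mem_Icc (f g : Measure BinSeq) (t : ℕ) (x : Fin t → Bool) :
    prefixRatio f g t x ∈ Icc (0 : ℝ) 1 := by
  unfold prefixRatio
  split_ifs
  · exact ⟨by positivity, div_le_one_of_le₀ (by simp) (by positivity)⟩
  · norm_num

lemma measurable_Dtest_succ (f g : Measure BinSeq) (t : ℕ) :
    Measurable[coordAlg t] (Dtest f g (t + 1)) := by
  rw [Dtest_succ]
  exact (measurable_of_finite (prefixRatio f g t)).comp (comap_measurable _)

lemma coordAlg_mono : Monotone coordAlg := by
  intro s t hst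
  have h : Measurable fun (x : Fin t → Bool) (i : Fin s) => x (Fin.castLE hst i) := by
    fun_prop
  exact (h.comp (comap_measurable (prefixMap t))).comap_le

lemma isCCTest_Dtest : IsCCTest Dtest := by
  intro f g _ _ t ht
  obtain ⟨t, rfl⟩ := Nat.exists_eq_add_of_le' ht
  refine ⟨fun ω => ?_,
    (measurable_Dtest_succ f g t).mono (coordAlg_mono t.le_succ) le_rfl⟩
  rw [Dtest_succ]
  exact prefixRatio_mem_Icc f g t _

lemma prefixRatio_swap (f g : Measure BinSeq) [IsFiniteMeasure f] [IsFiniteMeasure g]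
    (t : ℕ) (x : Fin t → Bool) : prefixRatio f g t x = 1 - prefixRatio g f t x := by
  unfold prefixRatio
  rw [add_comm (g _) (f _)]
  split_ifs with h
  · have h' : 0 < f.real (prefixMap t ⁻¹' {x}) + g.real (prefixMap t ⁻¹' {x}) := by
      simp only [Measure.real]
      rw [← ENNReal.toReal_add (measure_ne_top _ _) (measure_ne_top _ _)]
      exact ENNReal.toReal_pos h.ne' (by simp)
    have h'' : g.real (prefixMap t ⁻¹' {x}) + f.real (prefixMap t ⁻¹' {x}) ≠ 0 := by linarith
    have := h'.ne'
    field_simp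
    ring
  · norm_num

lemma anonymous_Dtest : Anonymous Dtest := by
  intro f g _ _ t ht ω
  obtain ⟨t, rfl⟩ := Nat.exists_eq_add_of_le' ht
  simp only [Dtest_succ, Function.comp]
  exact prefixRatio_swap f g t _

lemma Anonymous.LSet_eq_RSet {T : Test} (hT : Anonymous T) (f g : Measure BinSeq)
    [hf : IsProbabilityMeasure f] [hg : IsProbabilityMeasure g] (ε : ℝ) :
    LSet T f g ε = RSet T g f (1 - ε) := by
  ext ω
  have key : ∀ (f g : Measure BinSeq), IsProbabilityMeasure f → IsProbabilityMeasure g → ∀ l,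
      Tendsto (fun t => T f g t ω) atTop (nhds l) →
      Tendsto (fun t => T g f t ω) atTop (nhds (1 - l)) := by
    intro f g hf hg l hl
    refine (hl.const_sub 1).congr' ?_
    filter_upwards [eventually_ge_atTop 1] with t ht
    exact (hT g f hg hf t ht ω).symm
  constructor
  · rintro ⟨l, hl, h⟩
    exact ⟨1 - l, key f g hf hg l hl, by linarith⟩
  · rintro ⟨l, hl, h⟩
    exact ⟨1 - l, key g f hg hf l hl, by linarith⟩

/-- The filtration of `BinSeq` generated by the coordinates. -/
def coordFiltration : Filtration ℕ (inferInstance : MeasurableSpace BinSeq) where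
  seq := coordAlg
  mono' := coordAlg_mono
  le' t := (measurable_prefixMap t).comap_le

lemma iSup_coordFiltration :
    ⨆ t, coordFiltration t = (inferInstance : MeasurableSpace BinSeq) := by
  refine le_antisymm (iSup_le coordFiltration.le) (iSup_le fun i => ?_)
  refine le_trans ?_ (le_iSup _ (i + 1))
  have h : Measurable fun x : Fin (i + 1) → Bool => x (Fin.last i) := by fun_prop
  exact (h.comp (comap_measurable (prefixMap (i + 1)))).comap_le

lemma setIntegral_Dtest_succ (f g : Measure BinSeq) [IsFiniteMeasure f] [IsFiniteMeasure g]
    (t : ℕ) (S : Set (Fin t → Bool)) :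
    ∫ ω in prefixMap t ⁻¹' S, Dtest f g (t + 1) ω ∂(f + g) = f.real (prefixMap t ⁻¹' S) := by
  classical
  have hm := measurable_prefixMap t
  have hS : ((S.toFinset : Finset (Fin t → Bool)) : Set (Fin t → Bool)) = S := by simp
  simp only [Dtest_succ, Function.comp]
  rw [← setIntegral_map S.toFinite.measurableSet
    (measurable_of_finite _).aestronglyMeasurable hm.aemeasurable, ← hS,
    setIntegral_finset _ Integrable.of_finite.integrableOn,
    ← map_measureReal_apply hm (Finset.measurableSet _), ← sum_measureReal_singleton]
  refine Finset.sum_congr rfl fun x _ => ?_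
  rw [map_measureReal_apply hm (measurableSet_singleton x),
    map_measureReal_apply hm (measurableSet_singleton x), measureReal_add_apply, smul_eq_mul]
  unfold prefixRatio
  split_ifs with h
  · refine mul_div_cancel₀ _ ?_
    rw [← measureReal_add_apply, Measure.real]
    exact (ENNReal.toReal_pos h.ne' (measure_ne_top (f + g) _)).ne'
  · have h0 := add_eq_zero.1 (not_lt.1 h |>.antisymm zero_le)
    simp [Measure.real, h0.1, h0.2]

lemma absolutelyContinuous_add_of_right (f g : Measure BinSeq) : g ≪ f + g :=
  Measure.absolutelyContinuous_of_le (Measure.le_add_left le_rfl)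

lemma absolutelyContinuous_add_of_left (f g : Measure BinSeq) : f ≪ f + g :=
  Measure.absolutelyContinuous_of_le (Measure.le_add_right le_rfl)

lemma Dtest_succ_ae_eq_condExp (f g : Measure BinSeq) [IsFiniteMeasure f] [IsFiniteMeasure g]
    (t : ℕ) :
    Dtest f g (t + 1) =ᵐ[f + g]
      (f + g)[fun ω => (f.rnDeriv (f + g) ω).toReal | coordFiltration t] := by
  have hsm : StronglyMeasurable[coordFiltration t] (Dtest f g (t + 1)) :=
    (measurable_Dtest_succ f g t).stronglyMeasurable
  refine ae_eq_condExp_of_forall_setIntegral_eq (coordFiltration.le t)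
    Measure.integrable_toReal_rnDeriv (fun s _ _ => Integrable.integrableOn ?_) ?_
    hsm.aestronglyMeasurable
  · refine Integrable.of_bound (hsm.mono (coordFiltration.le t)).aestronglyMeasurable 1
      (.of_forall fun ω => ?_)
    rw [Dtest_succ, Real.norm_eq_abs, abs_le]
    have := prefixRatio_mem_Icc f g t (prefixMap t ω)
    exact ⟨neg_one_lt_zero.le.trans this.1, this.2⟩
  · rintro s ⟨S, -, rfl⟩ -
    rw [Measure.setIntegral_toReal_rnDeriv (absolutelyContinuous_add_of_left f g)]
    exact setIntegral_Dtest_succ f g t S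

lemma ae_tendsto_Dtest (f g : Measure BinSeq) [IsFiniteMeasure f] [IsFiniteMeasure g] :
    ∀ᵐ ω ∂(f + g), Tendsto (fun t => Dtest f g t ω) atTop
      (nhds (f.rnDeriv (f + g) ω).toReal) := by
  have hD : ∀ᵐ ω ∂(f + g), ∀ t, Dtest f g (t + 1) ω = _ :=
    ae_all_iff.2 (Dtest_succ_ae_eq_condExp f g)
  filter_upwards [hD, (Measure.integrable_toReal_rnDeriv
    (μ := f) (ν := f + g)).tendsto_ae_condExp (ℱ := coordFiltration) (by
      rw [iSup_coordFiltration]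
      exact (Measure.measurable_rnDeriv _ _).ennreal_toReal.stronglyMeasurable)] with ω h1 h2
  rw [← tendsto_add_atTop_iff_nat 1]
  simpa only [h1] using h2

/-- The set where the density of `f` relative to `f + g` is below `ε`. -/
def densityLT (f g : Measure BinSeq) (ε : ℝ) : Set BinSeq :=
  {ω | (f.rnDeriv (f + g) ω).toReal < ε}

lemma measurableSet_densityLT (f g : Measure BinSeq) (ε : ℝ) :
    MeasurableSet (densityLT f g ε) :=
  measurableSet_lt (Measure.measurable_rnDeriv _ _).ennreal_toReal measurable_const

lemma RSet_Dtest_ae_eq (f g : Measure BinSeq) [IsFiniteMeasure f] [IsFiniteMeasure g] (ε : ℝ) :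
    RSet Dtest f g ε =ᵐ[f + g] densityLT f g ε := by
  filter_upwards [ae_tendsto_Dtest f g] with ω h
  refine propext ⟨?_, fun h' => ⟨_, h, h'⟩⟩
  rintro ⟨l, hl, hlt⟩
  exact (tendsto_nhds_unique h hl).trans_lt hlt

lemma le_mul_of_subset_densityLT (f g : Measure BinSeq) [IsFiniteMeasure f] [IsFiniteMeasure g]
    {ε : ℝ} (hε1 : ε < 1) {B : Set BinSeq} (hB : MeasurableSet B)
    (h : B ⊆ densityLT f g ε) : f.real B ≤ ε / (1 - ε) * g.real B := by
  have h1 : f.real B ≤ ε * (f + g).real B := by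
    rw [← Measure.setIntegral_toReal_rnDeriv (absolutelyContinuous_add_of_left f g) B]
    calc _ ≤ ∫ _ in B, ε ∂(f + g) :=
          setIntegral_mono_on Measure.integrable_toReal_rnDeriv.integrableOn
            (integrable_const _).integrableOn hB fun ω hω => (h hω).le
      _ = _ := by rw [setIntegral_const, smul_eq_mul, mul_comm]
  rw [measureReal_add_apply] at h1
  rw [div_mul_eq_mul_div, le_div_iff₀ (by linarith)]
  linarith

lemma mul_le_of_disjoint_densityLT (f g : Measure BinSeq) [IsFiniteMeasure f]
    [IsFiniteMeasure g] {ε : ℝ} (hε1 : ε < 1) {B : Set BinSeq} (hB : MeasurableSet B)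
    (h : B ⊆ (densityLT f g ε)ᶜ) : ε / (1 - ε) * g.real B ≤ f.real B := by
  have h1 : ε * (f + g).real B ≤ f.real B := by
    rw [← Measure.setIntegral_toReal_rnDeriv (absolutelyContinuous_add_of_left f g) B]
    calc _ = ∫ _ in B, ε ∂(f + g) := by rw [setIntegral_const, smul_eq_mul, mul_comm]
      _ ≤ _ := setIntegral_mono_on (integrable_const _).integrableOn
            Measure.integrable_toReal_rnDeriv.integrableOn hB fun ω hω => not_lt.1 (h hω)
  rw [measureReal_add_apply] at h1
  rw [div_mul_eq_mul_div, div_le_iff₀ (by linarith)]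
  linarith

lemma measure_inter_RSet_Dtest_le (f g : Measure BinSeq) [IsFiniteMeasure f]
    [IsFiniteMeasure g] {ε : ℝ} (hε : ε ∈ Ioo 0 1) {A : Set BinSeq} (hA : MeasurableSet A) :
    f (A ∩ RSet Dtest f g ε) ≤ ENNReal.ofReal (ε / (1 - ε)) * g (A ∩ RSet Dtest f g ε) := by
  have hae := (ae_eq_refl A).inter (RSet_Dtest_ae_eq f g ε)
  have hc : 0 ≤ ε / (1 - ε) := div_nonneg hε.1.le (by linarith [hε.2])
  rw [measure_congr ((absolutelyContinuous_add_of_left f g).ae_le hae),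
    measure_congr ((absolutelyContinuous_add_of_right f g).ae_le hae),
    ← ofReal_measureReal, ← ofReal_measureReal, ← ENNReal.ofReal_mul hc]
  exact ENNReal.ofReal_le_ofReal (le_mul_of_subset_densityLT f g hε.2
    (hA.inter (measurableSet_densityLT f g ε)) inter_subset_right)

lemma measure_inter_RSet_Dtest_pos (f g : Measure BinSeq) [IsFiniteMeasure f]
    [IsFiniteMeasure g] {ε : ℝ} (hε : ε ∈ Ioo 0 1) {A : Set BinSeq} (hA : MeasurableSet A)
    (h : f A < ENNReal.ofReal (ε / (1 - ε)) * g A) : 0 < g (A ∩ RSet Dtest f g ε) := by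
  by_contra h0
  have hg0 : g (A ∩ RSet Dtest f g ε) = 0 := by simpa using h0
  have hc : 0 ≤ ε / (1 - ε) := div_nonneg hε.1.le (by linarith [hε.2])
  rw [measure_congr ((absolutelyContinuous_add_of_right f g).ae_le
    ((ae_eq_refl A).inter (RSet_Dtest_ae_eq f g ε)))] at hg0
  have hm := measurableSet_densityLT f g ε
  have hle := mul_le_of_disjoint_densityLT f g hε.2 (hA.diff hm) fun ω hω => hω.2
  have hgA : g (A \ densityLT f g ε) = g A := by
    rw [← measure_inter_add_sdiff A hm, hg0, zero_add]
  refine h.not_ge ?_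
  calc ENNReal.ofReal (ε / (1 - ε)) * g A
      = ENNReal.ofReal (ε / (1 - ε) * g.real (A \ densityLT f g ε)) := by
        rw [ENNReal.ofReal_mul hc, ofReal_measureReal, hgA]
    _ ≤ f (A \ densityLT f g ε) := by
        rw [← ofReal_measureReal]
        exact ENNReal.ofReal_le_ofReal hle
    _ ≤ f A := measure_mono sdiff_subset

lemma reasonable_Dtest : Reasonable Dtest := by
  intro f g _ _ A hA
  refine ⟨fun ε hε _ h => ?_, fun ε hε _ h => ?_⟩
  · exact measure_inter_RSet_Dtest_pos f g ⟨hε.1, by linarith [hε.2]⟩ hA h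
  · rw [anonymous_Dtest.LSet_eq_RSet]
    refine measure_inter_RSet_Dtest_pos g f
      ⟨by linarith [hε.2], by linarith [hε.1]⟩ hA ?_
    rwa [sub_sub_cancel]

lemma errorFree_Dtest : ErrorFree Dtest := by
  intro f g _ _ A hA
  refine ⟨fun ε hε => ?_, fun ε hε => ?_⟩
  · exact measure_inter_RSet_Dtest_le f g ⟨hε.1, by linarith [hε.2]⟩ hA
  · have h := measure_inter_RSet_Dtest_le g f (ε := 1 - ε)
      ⟨by linarith [hε.2], by linarith [hε.1]⟩ hA
    rw [sub_sub_cancel] at h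
    rwa [anonymous_Dtest.LSet_eq_RSet]

/-- The finite derivative test is an anonymous, reasonable and error-free cardinal
comparison test. -/
theorem stmt3 : IsCCTest Dtest ∧ Anonymous Dtest ∧ Reasonable Dtest ∧ ErrorFree Dtest :=
  ⟨isCCTest_Dtest, anonymous_Dtest, reasonable_Dtest, errorFree_Dtest⟩
end

section
/- Let f ≠ g be probability measures on Ω^∞ that are mutually singular. If T is a reasonable cardinal comparison test, then f(A_{T,f}^{(f,g)}) = 1 and g(A_{T,g}^{(f,g)}) = 1, i.e., T is decisive on f under f and decisive on g under g. -/
open MeasureTheory Filter Set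
open scoped ENNReal

theorem coordAlg_le (t : ℕ) : coordAlg t ≤ (inferInstance : MeasurableSpace BinSeq) := by
  have h : Measurable (fun (ω : BinSeq) (i : Fin t) => ω (i : ℕ)) :=
    measurable_pi_lambda _ fun i => measurable_pi_apply _
  exact h.comap_le

theorem measurableSet_exists_tendsto_lt {Ω : Type*} [MeasurableSpace Ω] {u : ℕ → Ω → ℝ}
    (hu : ∀ t, Measurable (u t)) (ε : ℝ) :
    MeasurableSet {ω | ∃ l : ℝ, Tendsto (fun t => u t ω) atTop (nhds l) ∧ l < ε} := by
  have h1 : MeasurableSet {ω | ∃ l : ℝ, Tendsto (fun t => u t ω) atTop (nhds l)} :=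
    measurableSet_exists_tendsto hu
  have h2 : MeasurableSet {ω | limsup (fun t => u t ω) atTop < ε} :=
    measurableSet_lt (Measurable.limsup hu) measurable_const
  convert h1.inter h2 using 1
  ext ω
  constructor
  · rintro ⟨l, hl, hlt⟩
    exact ⟨⟨l, hl⟩, by simpa [hl.limsup_eq] using hlt⟩
  · rintro ⟨⟨l, hl⟩, hlt⟩
    exact ⟨l, hl, by simpa [hl.limsup_eq] using hlt⟩

/-- If every non-null measurable part of a co-null set `S` charges the event that a nonnegative
process converges to a limit below `ε`, for all small `ε`, then the process converges to `0`
almost everywhere. -/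
theorem ae_tendsto_zero_of_forall_pos {Ω : Type*} [MeasurableSpace Ω] {μ : Measure Ω}
    {u : ℕ → Ω → ℝ} (hu : ∀ t, Measurable (u t)) (hu0 : ∀ t ω, 0 ≤ u t ω)
    {S : Set Ω} (hS : MeasurableSet S) (hμS : μ Sᶜ = 0)
    (h : ∀ ε ∈ Ioo (0 : ℝ) (1 / 2), ∀ A ⊆ S, MeasurableSet A → 0 < μ A →
      0 < μ (A ∩ {ω | ∃ l : ℝ, Tendsto (fun t => u t ω) atTop (nhds l) ∧ l < ε})) :
    ∀ᵐ ω ∂μ, Tendsto (fun t => u t ω) atTop (nhds 0) := by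
  have key : ∀ ε ∈ Ioo (0 : ℝ) (1 / 2),
      ∀ᵐ ω ∂μ, ∃ l : ℝ, Tendsto (fun t => u t ω) atTop (nhds l) ∧ l < ε := by
    intro ε hε
    set E := {ω | ∃ l : ℝ, Tendsto (fun t => u t ω) atTop (nhds l) ∧ l < ε} with hE
    have hEm : MeasurableSet E := measurableSet_exists_tendsto_lt hu ε
    have h0 : μ (S ∩ Eᶜ) = 0 := by
      by_contra hne
      have := h ε hε (S ∩ Eᶜ) inter_subset_left (hS.inter hEm.compl) (pos_iff_ne_zero.2 hne)
      simp [inter_assoc, ← hE] at this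
    have hSae : ∀ᵐ ω ∂μ, ω ∈ S := mem_ae_iff.2 hμS
    filter_upwards [hSae, measure_eq_zero_iff_ae_notMem.1 h0] with ω h1 h2
    by_contra hω
    exact h2 ⟨h1, hω⟩
  have hall : ∀ᵐ ω ∂μ, ∀ n : ℕ,
      ∃ l : ℝ, Tendsto (fun t => u t ω) atTop (nhds l) ∧ l < 1 / ((n : ℝ) + 3) := by
    refine ae_all_iff.2 fun n => key _ ⟨by positivity, ?_⟩
    have hn : (0 : ℝ) ≤ n := n.cast_nonneg
    exact one_div_lt_one_div_of_lt two_pos (by linarith)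
  filter_upwards [hall] with ω hω
  obtain ⟨l, hl, -⟩ := hω 0
  have hl0 : 0 ≤ l := ge_of_tendsto' hl fun t => hu0 t ω
  have hl1 : l ≤ 0 := by
    by_contra! hpos
    obtain ⟨n, hn⟩ := exists_nat_one_div_lt hpos
    obtain ⟨l', hl', hlt⟩ := hω n
    rw [tendsto_nhds_unique hl' hl] at hlt
    have : 1 / ((n : ℝ) + 3) ≤ 1 / ((n : ℝ) + 1) :=
      one_div_le_one_div_of_le (by positivity) (by linarith)
    linarith
  rwa [le_antisymm hl1 hl0] at hl

/-- A reasonable test perfectly distinguishes two mutually singular forecasters. -/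
theorem stmt16 (f g : Measure BinSeq) [IsProbabilityMeasure f] [IsProbabilityMeasure g]
    (hne : f ≠ g) (hsing : f ⟂ₘ g)
    (T : Test) (hT : IsCCTest T) (hReas : Reasonable T) :
    f {ω | Tendsto (fun t => T f g t ω) atTop (nhds 1)} = 1 ∧
    g {ω | Tendsto (fun t => T f g t ω) atTop (nhds 0)} = 1 := by
  obtain ⟨S, hS, hfS, hgS⟩ := hsing
  have hTfg := hT f g inferInstance inferInstance
  have hm : ∀ t, Measurable (T f g (t + 1)) := fun t =>
    (hTfg (t + 1) (by omega)).2.mono (coordAlg_le _) le_rfl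
  have hIcc : ∀ t ω, T f g (t + 1) ω ∈ Icc (0 : ℝ) 1 := fun t => (hTfg (t + 1) (by omega)).1
  have shift : ∀ ω l, Tendsto (fun t => T f g (t + 1) ω) atTop (nhds l) ↔
      Tendsto (fun t => T f g t ω) atTop (nhds l) := fun ω l =>
    tendsto_add_atTop_iff_nat (f := fun t => T f g t ω) 1
  have shift' : ∀ ω l, Tendsto (fun t => 1 - T f g (t + 1) ω) atTop (nhds l) ↔
      Tendsto (fun t => T f g t ω) atTop (nhds (1 - l)) := by
    intro ω l
    rw [← shift]
    exact ⟨fun h => by simpa using h.const_sub 1, fun h => by simpa using h.const_sub 1⟩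
  constructor
  · have hae := ae_tendsto_zero_of_forall_pos (μ := f) (u := fun t ω => 1 - T f g (t + 1) ω)
      (fun t => (hm t).const_sub 1) (fun t ω => sub_nonneg.2 (hIcc t ω).2) hS.compl
      (by rwa [compl_compl]) ?_
    · simp only [shift', sub_zero] at hae
      exact (measure_congr (eventuallyEq_univ.2 hae)).trans measure_univ
    · intro ε hε A hA hAm hpos
      have hr : 0 < ENNReal.ofReal ((1 - (1 - ε)) / (1 - ε)) :=
        ENNReal.ofReal_pos.2 (div_pos (by linarith [hε.1]) (by linarith [hε.2]))
      have hgA : g A = 0 := measure_mono_null hA hgS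
      refine ((hReas f g inferInstance inferInstance A hAm).2 (1 - ε)
        ⟨by linarith [hε.2], by linarith [hε.1]⟩ hpos
        (by rw [hgA]; exact ENNReal.mul_pos hr.ne' hpos.ne')).trans_le (measure_mono ?_)
      rintro ω ⟨hωA, l, hl, hlt⟩
      exact ⟨hωA, 1 - l, (shift' ω _).2 (by simpa using hl), by linarith⟩
  · have hae := ae_tendsto_zero_of_forall_pos (μ := g) (u := fun t ω => T f g (t + 1) ω)
      hm (fun t ω => (hIcc t ω).1) hS hgS ?_
    · simp only [shift] at hae
      exact (measure_congr (eventuallyEq_univ.2 hae)).trans measure_univ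
    · intro ε hε A hA hAm hpos
      have hr : 0 < ENNReal.ofReal (ε / (1 - ε)) :=
        ENNReal.ofReal_pos.2 (div_pos hε.1 (by linarith [hε.2]))
      have hfA : f A = 0 := measure_mono_null hA hfS
      refine ((hReas f g inferInstance inferInstance A hAm).1 ε hε hpos
        (by rw [hfA]; exact ENNReal.mul_pos hr.ne' hpos.ne')).trans_le (measure_mono ?_)
      rintro ω ⟨hωA, l, hl, hlt⟩
      exact ⟨hωA, l, (shift ω l).2 hl, hlt⟩
end
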